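/- arXiv:2305.16662 — 2 statements merged into one kernel-verified Lean document; each statement's English description precedes it below -/
import Mathlib

section
/- Let A and A' be unital associative ℂ-algebras such that A' has a countable basis as a ℂ-vector space. Let M be a module over A and let M' be a simple module over A'. Then the tensor product M ⊗_ℂ M', equipped with its natural module structure over the ℂ-algebra tensor product A ⊗_ℂ A' given by (a ⊗ a')·(m ⊗ m') = (a·m) ⊗ (a'·m'), is a simple A ⊗_ℂ A'-module if and only if M is a simple A-module. -/
open TensorProduct Cardinal

theorem aux_linInd {F E : Type*} [Field F] [DivisionRing E] [Algebra F E] {x : E}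
    (H : Transcendental F x) :
    LinearIndependent F fun a ↦ (x - algebraMap F E a)⁻¹ := by
  classical
  rw [transcendental_iff] at H
  refine linearIndependent_iff'.2 fun s m hm i hi ↦ ?_
  have hnz (a : F) : x - algebraMap F E a ≠ 0 := by
    intro h
    have h0 : Polynomial.aeval x (Polynomial.X - Polynomial.C a : Polynomial F) = 0 := by
      rw [map_sub, Polynomial.aeval_X, Polynomial.aeval_C, h]
    exact Polynomial.X_sub_C_ne_zero a (H _ h0)
  obtain ⟨b, hb0⟩ : ∃ b : Polynomial F, b = s.prod fun j ↦ .X - .C j := ⟨_, rfl⟩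
  have h1 : ∀ i ∈ s, m i • (Polynomial.aeval x b * (x - algebraMap F E i)⁻¹) =
      m i • Polynomial.aeval x ((s.erase i).prod fun j ↦ (.X - .C j : Polynomial F)) :=
      fun i hi ↦ by
    have hb : b = ((s.erase i).prod fun j ↦ (.X - .C j : Polynomial F)) * (.X - .C i) :=
      hb0.trans (s.prod_erase_mul _ hi).symm
    have hx : Polynomial.aeval x (.X - .C i : Polynomial F) = x - algebraMap F E i := by simp
    rw [hb, map_mul, hx, mul_inv_cancel_right₀ (hnz i)]
  replace hm := congrArg (fun z => Polynomial.aeval x b * z) hm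
  simp only [mul_zero, Finset.mul_sum, mul_smul_comm] at hm
  rw [Finset.sum_congr rfl h1] at hm
  obtain ⟨p, hp0⟩ : ∃ p : Polynomial F,
      p = s.sum fun i ↦ m i • (s.erase i).prod fun j ↦ .X - .C j := ⟨_, rfl⟩
  have hp : p = 0 := H p (by simp only [hp0, map_sum, map_smul]; exact hm)
  replace hm := congrArg (Polynomial.eval i) hp
  have h2 : ∀ j ∈ s.erase i, m j * ((s.erase j).prod fun x ↦ i - x) = 0 := fun j hj ↦ by
    have := Finset.mem_erase_of_ne_of_mem (Finset.ne_of_mem_erase hj).symm hi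
    simp_rw [← (s.erase j).prod_erase_mul _ this, sub_self, mul_zero]
  simp only [hp0, Polynomial.eval_finset_sum, Polynomial.eval_smul, Polynomial.eval_prod,
    Polynomial.eval_sub, Polynomial.eval_X, Polynomial.eval_C, Polynomial.eval_zero,
    smul_eq_mul] at hm
  rw [← s.sum_erase_add _ hi, Finset.sum_eq_zero h2, zero_add] at hm
  exact eq_zero_of_ne_zero_of_mul_right_eq_zero (Finset.prod_ne_zero_iff.2 fun j hj ↦
    sub_ne_zero.2 (Finset.ne_of_mem_erase hj).symm) hm

theorem aux_schur (A' : Type) [Ring A'] [Algebra ℂ A'] (hcount : Module.rank ℂ A' ≤ ℵ₀)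
    (M' : Type) [AddCommGroup M'] [Module ℂ M'] [Module A' M'] [IsScalarTower ℂ A' M']
    [IsSimpleModule A' M'] (g : Module.End A' M') : ∃ c : ℂ, ∀ x, g x = c • x := by
  classical
  have : Nontrivial M' := IsSimpleModule.nontrivial A' M'
  obtain ⟨v, hv⟩ := exists_ne (0 : M')
  have hs := IsSimpleModule.toSpanSingleton_surjective A' hv
  have hr1 : Module.rank ℂ M' ≤ ℵ₀ :=
    (LinearMap.rank_le_of_surjective ((LinearMap.toSpanSingleton A' M' v).restrictScalars ℂ) hs).trans hcount
  let ev : Module.End A' M' →ₗ[ℂ] M' :=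
    { toFun := fun f => f v, map_add' := fun _ _ => rfl, map_smul' := fun _ _ => rfl }
  have hev : Function.Injective ev := by
    intro f f' h
    ext x
    obtain ⟨a, rfl⟩ := hs x
    simp only [LinearMap.toSpanSingleton_apply, map_smul]
    exact congrArg _ h
  have hr : Module.rank ℂ (Module.End A' M') ≤ ℵ₀ :=
    (LinearMap.rank_le_of_injective ev hev).trans hr1
  have hint : Algebra.IsIntegral ℂ (Module.End A' M') := by
    refine ⟨fun x => ?_⟩
    by_contra hx
    have ht : Transcendental ℂ x := fun h => hx h.isIntegral
    have := (aux_linInd ht).cardinal_le_rank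
    rw [Cardinal.mk_complex] at this
    exact absurd (this.trans hr) (not_le.2 Cardinal.aleph0_lt_continuum)
  obtain ⟨c, hc⟩ := (IsAlgClosed.algebraMap_bijective_of_isIntegral (k := ℂ)
    (K := Module.End A' M')).2 g
  exact ⟨c, fun x => by rw [← hc]; rfl⟩

theorem aux_density (A' : Type) [Ring A'] [Algebra ℂ A'] (hcount : Module.rank ℂ A' ≤ ℵ₀)
    (M' : Type) [AddCommGroup M'] [Module ℂ M'] [Module A' M'] [IsScalarTower ℂ A' M']
    [IsSimpleModule A' M'] (f : M' →ₗ[ℂ] M') (s : Finset M') :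
    ∃ r : A', ∀ m ∈ s, f m = r • m := by
  let f' : Module.End (Module.End A' M') M' :=
    { toFun := f, map_add' := f.map_add
      map_smul' := fun g x => by
        obtain ⟨c, hc⟩ := aux_schur A' hcount M' g
        simp [hc] }
  exact jacobson_density f' s



/-- Let `A` and `A'` be unital associative `ℂ`-algebras such that `A'` has a
countable basis as a `ℂ`-vector space (equivalently, `Module.rank ℂ A' ≤ ℵ₀`). Let `M` be an
`A`-module and `M'` a simple `A'`-module. Then `M ⊗[ℂ] M'`, equipped with its natural
`A ⊗[ℂ] A'`-module structure determined by `(a ⊗ a') • (m ⊗ m') = (a • m) ⊗ (a' • m')`, is a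
simple `A ⊗[ℂ] A'`-module if and only if `M` is a simple `A`-module. -/
theorem simple_tensor_iff_simple_left
    (A A' : Type) [Ring A] [Algebra ℂ A] [Ring A'] [Algebra ℂ A']
    (hcount : Module.rank ℂ A' ≤ ℵ₀)
    (M : Type) [AddCommGroup M] [Module ℂ M] [Module A M] [IsScalarTower ℂ A M]
    (M' : Type) [AddCommGroup M'] [Module ℂ M'] [Module A' M'] [IsScalarTower ℂ A' M']
    (hM' : IsSimpleModule A' M')
    [Module (A ⊗[ℂ] A') (M ⊗[ℂ] M')]
    (hsmul : ∀ (a : A) (a' : A') (m : M) (m' : M'),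
      (a ⊗ₜ[ℂ] a') • (m ⊗ₜ[ℂ] m') = (a • m) ⊗ₜ[ℂ] (a' • m')) :
    IsSimpleModule (A ⊗[ℂ] A') (M ⊗[ℂ] M') ↔ IsSimpleModule A M := by
  classical
  have : Nontrivial M' := IsSimpleModule.nontrivial A' M'
  constructor
  · intro hS
    rw [isSimpleModule_iff_toSpanSingleton_surjective] at hS ⊢
    obtain ⟨hnt, hS⟩ := hS
    refine ⟨?_, fun x hx y => ?_⟩
    · by_contra h
      rw [not_nontrivial_iff_subsingleton] at h
      exact (not_subsingleton_iff_nontrivial.2 hnt) inferInstance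
    obtain ⟨m', hm'⟩ := exists_ne (0 : M')
    obtain ⟨φ, hφ⟩ := Module.Projective.exists_dual_ne_zero ℂ hm'
    let L : M ⊗[ℂ] M' →ₗ[ℂ] M := (TensorProduct.rid ℂ M).toLinearMap ∘ₗ φ.lTensor M
    have hL : ∀ m n, L (m ⊗ₜ n) = φ n • m := fun m n => by simp [L]
    have hne : x ⊗ₜ[ℂ] m' ≠ 0 := by
      intro h
      have := congrArg L h
      rw [hL, map_zero] at this
      exact (smul_ne_zero hφ hx) this
    have key : ∀ r : A ⊗[ℂ] A', L (r • (x ⊗ₜ m')) ∈ Submodule.span A {x} := by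
      intro r
      induction r using TensorProduct.induction_on with
      | zero => simp
      | add r s hr hs => rw [add_smul, map_add]; exact add_mem hr hs
      | tmul a a' =>
        rw [hsmul, hL, ← algebraMap_smul A]
        exact Submodule.smul_mem _ _ (Submodule.smul_mem _ _ (Submodule.mem_span_singleton_self x))
    obtain ⟨r, hr⟩ := hS _ hne (y ⊗ₜ m')
    have h := key r
    rw [LinearMap.toSpanSingleton_apply] at hr
    rw [hr, hL] at h
    obtain ⟨a, ha⟩ := Submodule.mem_span_singleton.1 h
    refine ⟨algebraMap ℂ A (φ m')⁻¹ * a, ?_⟩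
    rw [LinearMap.toSpanSingleton_apply, mul_smul, ha, algebraMap_smul, inv_smul_smul₀ hφ]
  · intro hM
    have : Nontrivial M := IsSimpleModule.nontrivial A M
    rw [isSimpleModule_iff_toSpanSingleton_surjective]
    refine ⟨inferInstance, fun t ht y => ?_⟩
    let C := Module.Basis.ofVectorSpace ℂ M'
    let b := TensorProduct.equivFinsuppOfBasisRight (M := M) C t
    have hb : t = b.sum fun i m ↦ m ⊗ₜ C i := by
      rw [← TensorProduct.equivFinsuppOfBasisRight_symm_apply]; simp [b]
    have hb0 : b ≠ 0 := by simpa [b] using ht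
    obtain ⟨i, hi⟩ := Finsupp.ne_iff.1 hb0
    rw [Finsupp.zero_apply] at hi
    change y ∈ LinearMap.range (LinearMap.toSpanSingleton (A ⊗[ℂ] A') _ t)
    induction y using TensorProduct.induction_on with
    | zero => exact zero_mem _
    | add y z hy hz => exact add_mem hy hz
    | tmul m w =>
      obtain ⟨a, ha⟩ := IsSimpleModule.toSpanSingleton_surjective A hi m
      rw [LinearMap.toSpanSingleton_apply] at ha
      obtain ⟨a', ha'⟩ := aux_density A' hcount M' ((C.coord i).smulRight w) (b.support.image C)
      refine ⟨a ⊗ₜ a', ?_⟩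
      rw [LinearMap.toSpanSingleton_apply, hb, Finsupp.sum, Finset.smul_sum,
        Finset.sum_eq_single i]
      · rw [hsmul, ha, ← ha' _ (Finset.mem_image_of_mem _ (Finsupp.mem_support_iff.2 hi))]
        simp
      · intro j hj hji
        rw [hsmul, ← ha' _ (Finset.mem_image_of_mem _ hj)]
        simp [hji]
      · intro h
        exact absurd (Finsupp.mem_support_iff.2 hi) h
end

section
/- Let 𝔞 and 𝔟 be Lie algebras over ℂ, with 𝔟 of countable dimension, and let 𝔤 = 𝔞 × 𝔟 be their product Lie algebra (direct sum of two ideals). Let V be a simple 𝔤-module, and suppose V contains a subspace H that is invariant under the action of the ideal {0} × 𝔟 and is a simple 𝔟-module under this action. Then there exists a simple 𝔞-module M such that V is isomorphic as a 𝔤-module to M ⊗_ℂ H, where the action is componentwise: (a, b)·(m ⊗ h) = (a·m) ⊗ h + m ⊗ (b·h). -/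
open TensorProduct Cardinal

section ProdLie

variable (L₁ L₂ : Type) [LieRing L₁] [LieRing L₂]

/-- The product of two Lie rings, with componentwise bracket. -/
instance Prod.instLieRing : LieRing (L₁ × L₂) where
  bracket p q := (⁅p.1, q.1⁆, ⁅p.2, q.2⁆)
  add_lie p q r := by
    ext
    · exact add_lie p.1 q.1 r.1
    · exact add_lie p.2 q.2 r.2
  lie_add p q r := by
    ext
    · exact lie_add p.1 q.1 r.1
    · exact lie_add p.2 q.2 r.2
  lie_self p := by
    ext
    · exact lie_self p.1
    · exact lie_self p.2
  leibniz_lie p q r := by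
    ext
    · exact leibniz_lie p.1 q.1 r.1
    · exact leibniz_lie p.2 q.2 r.2

/-- The product of two Lie algebras over `ℂ`, with componentwise bracket. -/
instance Prod.instLieAlgebra [LieAlgebra ℂ L₁] [LieAlgebra ℂ L₂] :
    LieAlgebra ℂ (L₁ × L₂) where
  lie_smul c p q := by
    ext
    · exact lie_smul c p.1 q.1
    · exact lie_smul c p.2 q.2

end ProdLie

section Helpers
set_option linter.unusedSectionVars false
variable {A B H V : Type} [LieRing B] [LieAlgebra ℂ B] [AddCommGroup H] [Module ℂ H] [LieRingModule B H] [LieModule ℂ B H]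

theorem aux_rank (hcount : Module.rank ℂ B ≤ ℵ₀) (hH : LieModule.IsIrreducible ℂ B H) :
    Module.rank ℂ H ≤ ℵ₀ := by
  have := LieModule.nontrivial_of_isIrreducible ℂ B H
  obtain ⟨h0, hne⟩ := exists_ne (0 : H)
  let bs := Module.Basis.ofVectorSpace ℂ B
  have hc : Countable (Module.Basis.ofVectorSpaceIndex ℂ B) := by
    rw [← Cardinal.mk_le_aleph0_iff, bs.mk_eq_rank'']
    exact hcount
  let g : List (Module.Basis.ofVectorSpaceIndex ℂ B) → H := fun l => l.foldr (fun b h => ⁅bs b, h⁆) h0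
  let N : LieSubmodule ℂ B H :=
    { Submodule.span ℂ (Set.range g) with
      lie_mem := by
        intro x m hm
        change m ∈ Submodule.span ℂ (Set.range g) at hm
        change ⁅x, m⁆ ∈ Submodule.span ℂ (Set.range g)
        induction hm using Submodule.span_induction with
        | mem y hy =>
          obtain ⟨l, rfl⟩ := hy
          have hx := bs.mem_span x
          induction hx using Submodule.span_induction with
          | mem z hz =>
            obtain ⟨i, rfl⟩ := hz
            exact Submodule.subset_span ⟨i :: l, rfl⟩
          | zero => simp
          | add a b _ _ ha hb => rw [add_lie]; exact add_mem ha hb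
          | smul c a _ ha => rw [smul_lie]; exact Submodule.smul_mem _ _ ha
        | zero => simp
        | add a b _ _ ha hb => rw [lie_add]; exact add_mem ha hb
        | smul c a _ ha => rw [lie_smul]; exact Submodule.smul_mem _ _ ha }
  have hN : N = ⊤ := by
    refine (eq_bot_or_eq_top N).resolve_left fun h => hne ?_
    have : h0 ∈ N := Submodule.subset_span ⟨[], rfl⟩
    rwa [h, LieSubmodule.mem_bot] at this
  have h2 : Submodule.span ℂ (Set.range g) = ⊤ := by
    have := congrArg LieSubmodule.toSubmodule hN
    simpa [N] using this
  rw [← rank_top ℂ H, ← h2]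
  refine (rank_span_le _).trans ?_
  rw [Cardinal.mk_le_aleph0_iff]
  exact (Set.countable_range g).to_subtype

theorem aux_spec (hr : Module.rank ℂ H ≤ ℵ₀) [Nontrivial H] (φ : Module.End ℂ H) :
    (spectrum ℂ φ).Nonempty := by
  by_contra hemp
  rw [Set.not_nonempty_iff_eq_empty] at hemp
  obtain ⟨h0, hne⟩ := exists_ne (0 : H)
  have hu : ∀ z : ℂ, IsUnit (φ - algebraMap ℂ _ z) := by
    intro z
    have : z ∉ spectrum ℂ φ := by simp [hemp]
    rw [spectrum.notMem_iff] at this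
    rw [← neg_sub]; exact this.neg
  have hp : ∀ p : Polynomial ℂ, p ≠ 0 → IsUnit (Polynomial.aeval φ p) := by
    intro p hp0
    by_cases hd : 0 < p.degree
    · have := spectrum.map_polynomial_aeval_of_degree_pos φ p hd
      rw [hemp, Set.image_empty] at this
      have h0 : (0 : ℂ) ∉ spectrum ℂ (Polynomial.aeval φ p) := by simp [this]
      rwa [spectrum.zero_notMem_iff] at h0
    · have := Polynomial.eq_C_of_degree_le_zero (not_lt.mp hd)
      rw [this] at hp0 ⊢
      rw [Polynomial.aeval_C]
      exact (IsUnit.mk0 _ (by simpa using hp0)).map _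
  choose u hu using hu
  have hinv : ∀ z (h : H), (φ - algebraMap ℂ _ z) ((↑(u z)⁻¹ : Module.End ℂ H) h) = h := by
    intro z h
    rw [← hu z, ← Module.End.mul_apply, Units.mul_inv, Module.End.one_apply]
  have hli : LinearIndependent ℂ (fun z : ℂ => (↑(u z)⁻¹ : Module.End ℂ H) h0) := by
    rw [linearIndependent_iff']
    intro s c hs k hk
    let q : Polynomial ℂ := ∑ i ∈ s, Polynomial.C (c i) * ∏ j ∈ s.erase i, (Polynomial.X - Polynomial.C j)
    have hq : Polynomial.aeval φ q h0 = 0 := by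
      have h1 := congrArg (Polynomial.aeval φ (∏ j ∈ s, (Polynomial.X - Polynomial.C j))) hs
      rw [map_zero, map_sum] at h1
      rw [← h1]
      simp only [q, map_sum, LinearMap.sum_apply]
      refine Finset.sum_congr rfl fun i hi => ?_
      rw [← Finset.prod_erase_mul s _ hi, map_smul, map_mul, map_mul, Module.End.mul_apply, Module.End.mul_apply]
      have := hinv i h0
      rw [map_sub, Polynomial.aeval_X, Polynomial.aeval_C, Polynomial.aeval_C, this,
        Module.algebraMap_end_apply]
    by_contra hck
    have hq0 : q ≠ 0 := by
      intro h
      have h2 := congrArg (Polynomial.eval k) h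
      simp only [q, Polynomial.eval_finsetSum, Polynomial.eval_mul, Polynomial.eval_C, Polynomial.eval_prod, Polynomial.eval_sub, Polynomial.eval_X, Polynomial.eval_zero] at h2
      rw [Finset.sum_eq_single_of_mem k hk] at h2
      · rcases mul_eq_zero.mp h2 with h3 | h3
        · exact hck h3
        · obtain ⟨j, hj, hj2⟩ := Finset.prod_eq_zero_iff.mp h3
          exact (Finset.mem_erase.mp hj).1 (sub_eq_zero.mp hj2).symm
      · intro i hi hik
        rw [Finset.prod_eq_zero (Finset.mem_erase.mpr ⟨hik.symm, hk⟩) (sub_self k), mul_zero]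
    obtain ⟨w, hw⟩ := hp q hq0
    apply hne
    have : (↑w⁻¹ * ↑w : Module.End ℂ H) h0 = 0 := by
      rw [Module.End.mul_apply, hw, hq, map_zero]
    simpa using this
  have := hli.cardinal_le_rank.trans hr
  rw [Cardinal.mk_complex] at this
  exact absurd this (not_le.mpr Cardinal.aleph0_lt_continuum)

theorem aux_schur_s3 (hcount : Module.rank ℂ B ≤ ℵ₀) (hH : LieModule.IsIrreducible ℂ B H)
    (φ : H →ₗ[ℂ] H) (hφ : ∀ (b : B) h, φ ⁅b, h⁆ = ⁅b, φ h⁆) : ∃ c : ℂ, ∀ h, φ h = c • h := by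
  have := LieModule.nontrivial_of_isIrreducible ℂ B H
  obtain ⟨c, hc⟩ := aux_spec (aux_rank hcount hH) φ
  refine ⟨c, ?_⟩
  let ψ : H →ₗ⁅ℂ, B⁆ H := { (algebraMap ℂ (Module.End ℂ H) c - φ) with
    map_lie' := by
      intro x m
      simp [hφ] }
  have hψ : ∀ h, ψ h = c • h - φ h := fun h => rfl
  rcases eq_bot_or_eq_top ψ.ker with hk | hk
  · rcases eq_bot_or_eq_top ψ.range with hR | hR
    · intro h
      have : ψ h ∈ ψ.range := by simp
      rw [hR, LieSubmodule.mem_bot, hψ, sub_eq_zero] at this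
      exact this.symm
    · exfalso
      apply hc
      change IsUnit _
      rw [Module.End.isUnit_iff]
      refine ⟨(LieModuleHom.ker_eq_bot ψ).mp hk, ?_⟩
      exact (LieModuleHom.range_eq_top ψ).mp hR
  · intro h
    have : h ∈ ψ.ker := by simp [hk]
    rw [LieModuleHom.mem_ker, hψ, sub_eq_zero] at this
    exact this.symm

variable [LieRing A] [LieAlgebra ℂ A] [AddCommGroup V] [Module ℂ V]
  [LieRingModule (A × B) V] [LieModule ℂ (A × B) V]

theorem aux_indep (hcount : Module.rank ℂ B ≤ ℵ₀) (hH : LieModule.IsIrreducible ℂ B H)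
    {I : Type} (f : I → H →ₗ[ℂ] V) (hf : LinearIndependent ℂ f)
    (hfB : ∀ i (b : B) h, f i ⁅b, h⁆ = ⁅((0 : A), b), f i h⁆) (s : Finset I) :
    ∀ x : I → H, ∑ i ∈ s, f i (x i) = 0 → ∀ i ∈ s, x i = 0 := by
  classical
  induction s using Finset.induction_on with
  | empty => simp
  | insert k s hks ih =>
    intro x hx
    rw [Finset.sum_insert hks] at hx
    by_cases hxk : x k = 0
    · rw [hxk, map_zero, zero_add] at hx
      intro i hi
      rcases Finset.mem_insert.mp hi with rfl | hi
      · exact hxk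
      · exact ih x hx i hi
    exfalso
    let N : LieSubmodule ℂ B H :=
      { carrier := {h | ∃ y : I → H, f k h = ∑ i ∈ s, f i (y i)}
        zero_mem' := ⟨0, by simp⟩
        add_mem' := by
          rintro a b ⟨y, hy⟩ ⟨z, hz⟩
          exact ⟨y + z, by simp [hy, hz, Finset.sum_add_distrib]⟩
        smul_mem' := by
          rintro c a ⟨y, hy⟩
          exact ⟨c • y, by simp [hy, Finset.smul_sum]⟩
        lie_mem := by
          rintro b a ⟨y, hy⟩
          exact ⟨fun i => ⁅b, y i⁆, by simp [hfB, hy, lie_sum]⟩ }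
    have hN : N = ⊤ := by
      refine (eq_bot_or_eq_top N).resolve_left fun h => hxk ?_
      have : x k ∈ N := ⟨-x, by simpa [Finset.sum_neg_distrib] using eq_neg_of_add_eq_zero_left hx⟩
      rwa [h, LieSubmodule.mem_bot] at this
    have hall : ∀ h, ∃ y : I → H, f k h = ∑ i ∈ s, f i (y i) := by
      intro h
      have : h ∈ N := by simp [hN]
      exact this
    choose y hy using hall
    have huniq : ∀ (h : H) (z : I → H), f k h = ∑ i ∈ s, f i (z i) → ∀ i ∈ s, y h i = z i := by
      intro h z hz i hi
      have := ih (y h - z) (by simp [Finset.sum_sub_distrib, ← hz, ← hy]) i hi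
      exact sub_eq_zero.mp this
    have hsc : ∀ i : I, ∃ c : ℂ, i ∈ s → ∀ h, y h i = c • h := by
      intro i
      by_cases hi : i ∈ s
      · let φ : H →ₗ[ℂ] H :=
          { toFun := fun h => y h i
            map_add' := fun a b => huniq (a + b) (y a + y b)
              (by simp [hy a, hy b, Finset.sum_add_distrib]) i hi
            map_smul' := fun c a => huniq (c • a) (c • y a)
              (by simp [hy a, Finset.smul_sum]) i hi }
        obtain ⟨c, hc⟩ := aux_schur_s3 hcount hH φ (fun b h => huniq ⁅b, h⁆ (fun j => ⁅b, y h j⁆)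
          (by simp [hfB, hy h, lie_sum]) i hi)
        exact ⟨c, fun _ => hc⟩
      · exact ⟨0, fun h => absurd h hi⟩
    choose c hc using hsc
    have hk : f k = ∑ i ∈ s, c i • f i := by
      ext h
      rw [hy h, LinearMap.sum_apply]
      refine Finset.sum_congr rfl fun i hi => ?_
      rw [hc i hi h, map_smul, LinearMap.smul_apply]
    refine hf.notMem_span_image (s := (s : Set I)) (x := k) (by simpa using hks) ?_
    rw [hk]
    exact Submodule.sum_mem _ fun i hi =>
      Submodule.smul_mem _ _ (Submodule.subset_span ⟨i, hi, rfl⟩)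

variable (A B H V) in
/-- The `B`-equivariant maps from `H` to `V`. -/
def auxHom : Submodule ℂ (H →ₗ[ℂ] V) where
  carrier := {f | ∀ (b : B) h, f ⁅b, h⁆ = ⁅((0 : A), b), f h⁆}
  zero_mem' := by intro b h; simp
  add_mem' := by intro f g hf hg b h; simp [hf b h, hg b h]
  smul_mem' := by intro c f hf b h; simp [hf b h]

theorem aux_comm (a : A) (b : B) (v : V) :
    ⁅((0 : A), b), ⁅(a, (0 : B)), v⁆⁆ = ⁅(a, (0 : B)), ⁅((0 : A), b), v⁆⁆ := by
  rw [leibniz_lie]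
  have : ⁅((0 : A), b), (a, (0 : B))⁆ = 0 := by
    change (⁅(0 : A), a⁆, ⁅b, (0 : B)⁆) = 0
    simp
  rw [this, zero_lie, zero_add]

theorem aux_split (a : A) (b : B) (v : V) :
    ⁅(a, b), v⁆ = ⁅(a, (0 : B)), v⁆ + ⁅((0 : A), b), v⁆ := by
  rw [← add_lie]; simp

instance auxLRM : LieRingModule A (auxHom A B H V) where
  bracket a f := ⟨{ toFun := fun h => ⁅(a, (0 : B)), f.1 h⁆
                    map_add' := by intro x y; simp
                    map_smul' := by intro c x; simp }, by
      intro b h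
      change ⁅(a, (0 : B)), f.1 ⁅b, h⁆⁆ = ⁅((0 : A), b), ⁅(a, (0 : B)), f.1 h⁆⁆
      rw [f.2 b h, aux_comm]⟩
  add_lie a a' f := by
    ext h
    change ⁅(a + a', (0 : B)), f.1 h⁆ = ⁅(a, (0 : B)), f.1 h⁆ + ⁅(a', (0 : B)), f.1 h⁆
    rw [← add_lie]; simp
  lie_add a f g := by
    ext h
    change ⁅(a, (0 : B)), f.1 h + g.1 h⁆ = ⁅(a, (0 : B)), f.1 h⁆ + ⁅(a, (0 : B)), g.1 h⁆
    rw [lie_add]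
  leibniz_lie a a' f := by
    ext h
    change ⁅(a, (0 : B)), ⁅(a', (0 : B)), f.1 h⁆⁆ =
      ⁅(⁅a, a'⁆, (0 : B)), f.1 h⁆ + ⁅(a', (0 : B)), ⁅(a, (0 : B)), f.1 h⁆⁆
    rw [leibniz_lie]
    have : ⁅(a, (0 : B)), (a', (0 : B))⁆ = (⁅a, a'⁆, (0 : B)) := by
      change (⁅a, a'⁆, ⁅(0 : B), (0 : B)⁆) = _
      simp
    rw [this]

theorem aux_lie_apply (a : A) (f : auxHom A B H V) (h : H) :
    (⁅a, f⁆ : auxHom A B H V).1 h = ⁅(a, (0 : B)), f.1 h⁆ := rfl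

instance auxLM : LieModule ℂ A (auxHom A B H V) where
  smul_lie c a f := by
    ext h
    change ⁅(c • a, (0 : B)), f.1 h⁆ = c • ⁅(a, (0 : B)), f.1 h⁆
    rw [← smul_lie]; simp
  lie_smul c a f := by
    ext h
    change ⁅(a, (0 : B)), c • f.1 h⁆ = c • ⁅(a, (0 : B)), f.1 h⁆
    rw [lie_smul]

variable (A B H V) in
/-- Evaluation. -/
noncomputable def auxEv : auxHom A B H V ⊗[ℂ] H →ₗ[ℂ] V :=
  TensorProduct.lift (auxHom A B H V).subtype

theorem auxEv_tmul (f : auxHom A B H V) (h : H) : auxEv A B H V (f ⊗ₜ h) = f.1 h := rfl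

theorem auxEv_inj (hcount : Module.rank ℂ B ≤ ℵ₀) (hH : LieModule.IsIrreducible ℂ B H) :
    Function.Injective (auxEv A B H V) := by
  classical
  rw [injective_iff_map_eq_zero]
  intro t ht
  let bs := Module.Basis.ofVectorSpace ℂ (auxHom A B H V)
  let e := TensorProduct.equivFinsuppOfBasisLeft (N := H) bs
  obtain ⟨x, rfl⟩ := e.symm.surjective t
  have h1 : ∑ i ∈ x.support, (bs i).1 (x i) = 0 := by
    rw [← ht, TensorProduct.equivFinsuppOfBasisLeft_symm_apply, Finsupp.sum, map_sum]
    rfl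
  have hli : LinearIndependent ℂ (fun i => (bs i).1) :=
    bs.linearIndependent.map' (auxHom A B H V).subtype (Submodule.ker_subtype _)
  have h2 := aux_indep hcount hH _ hli (fun i => (bs i).2) x.support x h1
  have : x = 0 := by
    ext i
    by_cases hi : i ∈ x.support
    · exact h2 i hi
    · simpa using hi
  rw [this, map_zero]

/-- The submodule of `V` generated by an `A`-submodule of the equivariant maps. -/
noncomputable def auxSub (N : LieSubmodule ℂ A (auxHom A B H V)) : LieSubmodule ℂ (A × B) V :=
  { LinearMap.range (auxEv A B H V ∘ₗ LinearMap.rTensor H N.toSubmodule.subtype) with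
    lie_mem := by
      rintro ⟨a, b⟩ _ ⟨t, rfl⟩
      change _ ∈ LinearMap.range (auxEv A B H V ∘ₗ LinearMap.rTensor H N.toSubmodule.subtype)
      induction t with
      | zero => simp
      | add x y hx hy => rw [map_add, lie_add]; exact add_mem hx hy
      | tmul f h =>
        refine ⟨(⟨⁅a, f.1⁆, N.lie_mem f.2⟩ : N.toSubmodule) ⊗ₜ h + f ⊗ₜ ⁅b, h⁆, ?_⟩
        rw [map_add]
        change (⁅a, f.1⁆ : auxHom A B H V).1 h + f.1.1 ⁅b, h⁆ = ⁅(a, b), f.1.1 h⁆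
        rw [aux_lie_apply, f.1.2 b h, ← aux_split] }

theorem mem_auxSub (N : LieSubmodule ℂ A (auxHom A B H V)) (v : V) :
    v ∈ auxSub N ↔ ∃ t, auxEv A B H V (LinearMap.rTensor H N.toSubmodule.subtype t) = v :=
  Iff.rfl

theorem auxSub_top (hV : LieModule.IsIrreducible ℂ (A × B) V)
    (N : LieSubmodule ℂ A (auxHom A B H V)) (hN : N ≠ ⊥) : auxSub N = ⊤ := by
  refine (eq_bot_or_eq_top _).resolve_left fun h => hN ?_
  rw [eq_bot_iff]
  intro f hf
  rw [LieSubmodule.mem_bot]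
  ext x
  have : f.1 x ∈ auxSub N := ⟨(⟨f, hf⟩ : N.toSubmodule) ⊗ₜ x, rfl⟩
  rwa [h, LieSubmodule.mem_bot] at this

theorem auxHom_irr (hcount : Module.rank ℂ B ≤ ℵ₀) (hH : LieModule.IsIrreducible ℂ B H)
    (hV : LieModule.IsIrreducible ℂ (A × B) V) [Nontrivial (auxHom A B H V)] :
    LieModule.IsIrreducible ℂ A (auxHom A B H V) := by
  refine LieModule.IsIrreducible.mk fun N hN => ?_
  have := LieModule.nontrivial_of_isIrreducible ℂ B H
  obtain ⟨h0, hne⟩ := exists_ne (0 : H)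
  have htop := auxSub_top hV N hN
  rw [eq_top_iff]
  intro f _
  by_contra hf
  obtain ⟨l, hl, hle⟩ := Submodule.exists_le_ker_of_notMem (p := N.toSubmodule) (v := f) hf
  have : f.1 h0 ∈ auxSub N := by simp [htop]
  obtain ⟨t, ht⟩ := (mem_auxSub N _).mp this
  rw [← auxEv_tmul] at ht
  have ht2 := auxEv_inj hcount hH ht
  have h3 := congrArg (LinearMap.rTensor H l) ht2
  rw [← LinearMap.comp_apply, ← LinearMap.rTensor_comp] at h3
  have h4 : l ∘ₗ N.toSubmodule.subtype = 0 := by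
    ext x
    exact hle x.2
  rw [h4, LinearMap.rTensor_zero, LinearMap.zero_apply, LinearMap.rTensor_tmul] at h3
  have h5 := congrArg (TensorProduct.lid ℂ H) h3
  rw [map_zero, TensorProduct.lid_tmul] at h5
  exact (smul_ne_zero hl hne) h5.symm

end Helpers


/-- Let `𝔞` and `𝔟` be Lie algebras over `ℂ`, with `𝔟` of countable dimension,
and let `𝔤 = 𝔞 × 𝔟` be their product. Let `V` be a simple `𝔤`-module containing a subspace `H`
(presented here as an injective linear map `ι : H →ₗ[ℂ] V`) invariant under the ideal `{0} × 𝔟`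
and simple as a `𝔟`-module under this action. Then there exists a simple `𝔞`-module `M` such
that `V ≅ M ⊗[ℂ] H` as `(𝔞 × 𝔟)`-modules, where the action on the tensor product is
componentwise: `(a, b)·(m ⊗ h) = (a·m) ⊗ h + m ⊗ (b·h)`. -/
theorem simple_module_over_prod_lie_is_tensor
    (A B : Type) [LieRing A] [LieAlgebra ℂ A] [LieRing B] [LieAlgebra ℂ B]
    (hcount : Module.rank ℂ B ≤ ℵ₀)
    (V : Type) [AddCommGroup V] [Module ℂ V]
    [LieRingModule (A × B) V] [LieModule ℂ (A × B) V]
    (hV : LieModule.IsIrreducible ℂ (A × B) V)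
    (H : Type) [AddCommGroup H] [Module ℂ H] [LieRingModule B H] [LieModule ℂ B H]
    (ι : H →ₗ[ℂ] V) (hι : Function.Injective ι)
    (hequiv : ∀ (b : B) (h : H), ι ⁅b, h⁆ = ⁅((0 : A), b), ι h⁆)
    (hH : LieModule.IsIrreducible ℂ B H) :
    ∃ (M : Type) (_ : AddCommGroup M) (_ : Module ℂ M) (_ : LieRingModule A M)
      (_ : LieModule ℂ A M),
      LieModule.IsIrreducible ℂ A M ∧
      ∃ (_ : LieRingModule (A × B) (M ⊗[ℂ] H)) (_ : LieModule ℂ (A × B) (M ⊗[ℂ] H)),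
        (∀ (a : A) (b : B) (m : M) (h : H),
          ⁅((a, b) : A × B), m ⊗ₜ[ℂ] h⁆ = ⁅a, m⁆ ⊗ₜ[ℂ] h + m ⊗ₜ[ℂ] ⁅b, h⁆) ∧
        Nonempty (V ≃ₗ⁅ℂ, A × B⁆ (M ⊗[ℂ] H)) := by
  have := LieModule.nontrivial_of_isIrreducible ℂ B H
  obtain ⟨h0, hne⟩ := exists_ne (0 : H)
  have : Nontrivial (auxHom A B H V) := by
    refine ⟨⟨⟨ι, hequiv⟩, 0, fun h => hne (hι ?_)⟩⟩
    have := congrArg (fun f : auxHom A B H V => f.1 h0) h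
    rw [map_zero]
    exact this
  have hsurj : Function.Surjective (auxEv A B H V) := by
    intro v
    have : v ∈ auxSub (⊤ : LieSubmodule ℂ A (auxHom A B H V)) := by
      rw [auxSub_top hV _ top_ne_bot]; simp
    obtain ⟨t, ht⟩ := (mem_auxSub _ _).mp this
    exact ⟨_, ht⟩
  let e : (auxHom A B H V) ⊗[ℂ] H ≃ₗ[ℂ] V :=
    LinearEquiv.ofBijective (auxEv A B H V) ⟨auxEv_inj hcount hH, hsurj⟩
  let i1 : LieRingModule (A × B) (auxHom A B H V ⊗[ℂ] H) :=
    { bracket := fun x t => e.symm ⁅x, e t⁆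
      add_lie := fun x y t => by
        change e.symm ⁅x + y, e t⁆ = e.symm ⁅x, e t⁆ + e.symm ⁅y, e t⁆
        rw [add_lie, map_add]
      lie_add := fun x t u => by
        change e.symm ⁅x, e (t + u)⁆ = e.symm ⁅x, e t⁆ + e.symm ⁅x, e u⁆
        rw [map_add, lie_add, map_add]
      leibniz_lie := fun x y t => by
        change e.symm ⁅x, e (e.symm ⁅y, e t⁆)⁆ =
          e.symm ⁅⁅x, y⁆, e t⁆ + e.symm ⁅y, e (e.symm ⁅x, e t⁆)⁆
        rw [e.apply_symm_apply, e.apply_symm_apply, leibniz_lie, map_add] }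
  have hb : ∀ (x : A × B) (t : auxHom A B H V ⊗[ℂ] H), ⁅x, t⁆ = e.symm ⁅x, e t⁆ :=
    fun _ _ => rfl
  let i2 : LieModule ℂ (A × B) (auxHom A B H V ⊗[ℂ] H) :=
    { smul_lie := fun c x t => by rw [hb, hb, smul_lie, map_smul]
      lie_smul := fun c x t => by rw [hb, hb, map_smul, lie_smul, map_smul] }
  refine ⟨auxHom A B H V, inferInstance, inferInstance, auxLRM, auxLM,
    auxHom_irr hcount hH hV, i1, i2, ?_, ⟨{ e.symm with map_lie' := ?_ }⟩⟩
  · intro a b f h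
    rw [hb, LinearEquiv.symm_apply_eq, map_add]
    change ⁅(a, b), f.1 h⁆ = (⁅a, f⁆ : auxHom A B H V).1 h + f.1 ⁅b, h⁆
    rw [aux_lie_apply, f.2 b h, ← aux_split]
  · intro x v
    change e.symm ⁅x, v⁆ = e.symm ⁅x, e (e.symm v)⁆
    rw [e.apply_symm_apply]
end
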